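/- arXiv:1208.4827 — 2 statements merged into one kernel-verified Lean document; each statement's English description precedes it below -/
import Mathlib

section
/- Let L0 be a closed densely defined symmetric positive definite operator in a complex Hilbert space H, K := Ker L0*, and L a positive definite self-adjoint extension of L0 with bounded everywhere-defined inverse L⁻¹. Suppose u, v ∈ Dom L0* are decomposed as u = u0 + L⁻¹ g_u + h_u and v = v0 + L⁻¹ g_v + h_v with u0, v0 ∈ Dom L0 and g_u, h_u, g_v, h_v ∈ K. Then ⟪L0* u, v⟫ − ⟪u, L0* v⟫ = ⟪g_u, h_v⟫ − ⟪h_u, g_v⟫. -/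
local notation "⟪" x ", " y "⟫" => @inner ℂ _ _ x y

/-- The kernel of a partially defined linear operator, as a submodule of the ambient space. -/
def pker {H : Type*} [NormedAddCommGroup H] [InnerProductSpace ℂ H]
    (T : H →ₗ.[ℂ] H) : Submodule ℂ H :=
  (LinearMap.ker T.toFun).map T.domain.subtype

/-- The kernel of the adjoint of a densely defined operator is orthogonal to its range. -/
theorem inner_apply_eq_zero_of_mem_pker_adjoint {H : Type*} [NormedAddCommGroup H]
    [InnerProductSpace ℂ H] [CompleteSpace H] {T : H →ₗ.[ℂ] H}
    (hT : Dense (T.domain : Set H)) {h : H} (hh : h ∈ pker T.adjoint) (x : T.domain) :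
    ⟪h, T x⟫ = 0 := by
  obtain ⟨y, hy, rfl⟩ := hh
  have hy' : T.adjoint y = 0 := hy
  have := T.adjoint_isFormalAdjoint hT y x
  rw [hy', inner_zero_left] at this
  exact this.symm

/-- If `S` is a bounded self-adjoint left inverse of `T`, then `T† (w + S g + h) = T w + g` for
`w` in the domain of the symmetric operator `T` and `h` in the kernel of `T†`. -/
theorem adjoint_apply_of_eq_add {H : Type*} [NormedAddCommGroup H]
    [InnerProductSpace ℂ H] [CompleteSpace H] {T : H →ₗ.[ℂ] H}
    (hT : Dense (T.domain : Set H)) (hsym : ∀ u v : T.domain, ⟪T u, (v : H)⟫ = ⟪(u : H), T v⟫)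
    {S : H →L[ℂ] H} (hS : ∀ x y : H, ⟪S x, y⟫ = ⟪x, S y⟫) (hST : ∀ x : T.domain, S (T x) = x)
    {u : T.adjoint.domain} {w : T.domain} {g h : H} (hh : h ∈ pker T.adjoint)
    (hu : (u : H) = (w : H) + S g + h) : T.adjoint u = T w + g := by
  refine T.adjoint_apply_eq hT u fun x => ?_
  rw [hu, inner_add_left, inner_add_left, inner_add_left, hsym, hS, hST,
    inner_apply_eq_zero_of_mem_pker_adjoint hT hh, add_zero]

/-- Computation of the boundary form via Vishik decompositions. -/
theorem statement3 {H : Type*} [NormedAddCommGroup H] [InnerProductSpace ℂ H] [CompleteSpace H]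
    (L0 : H →ₗ.[ℂ] H)
    (hdense : Dense (L0.domain : Set H))
    (hclosed : L0.IsClosed)
    (hsym : ∀ u v : L0.domain, ⟪L0 u, (v : H)⟫ = ⟪(u : H), L0 v⟫)
    (κ : ℝ) (hκ : 0 < κ)
    (hpos : ∀ y : L0.domain, κ * ‖(y : H)‖ ^ 2 ≤ (⟪L0 y, (y : H)⟫).re)
    -- `L` is a self-adjoint extension of `L0`, positive definite, bijective onto `H`
    (L : H →ₗ.[ℂ] H) (hL0L : L0 ≤ L) (hLsa : L.adjoint = L)
    (hLpos : ∀ y : L.domain, κ * ‖(y : H)‖ ^ 2 ≤ (⟪L y, (y : H)⟫).re)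
    -- `Linv` is the (bounded, everywhere-defined, self-adjoint) inverse of `L`
    (Linv : H →L[ℂ] H) (hLinvsa : IsSelfAdjoint Linv)
    (hinvl : ∀ x : L.domain, Linv (L x) = (x : H))
    (hinvmem : ∀ x : H, Linv x ∈ L.domain)
    (hinvr : ∀ x : H, L ⟨Linv x, hinvmem x⟩ = x)
    :
    ∀ (u v : L0.adjoint.domain) (u0 v0 : L0.domain) (gu hu gv hv : H),
      gu ∈ pker L0.adjoint → hu ∈ pker L0.adjoint →
      gv ∈ pker L0.adjoint → hv ∈ pker L0.adjoint →
      (u : H) = (u0 : H) + Linv gu + hu → (v : H) = (v0 : H) + Linv gv + hv →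
      ⟪L0.adjoint u, (v : H)⟫ - ⟪(u : H), L0.adjoint v⟫ = ⟪gu, hv⟫ - ⟪hu, gv⟫ := by
  intro u v u0 v0 gu hu gv hv _ hhu _ hhv hueq hveq
  have hS : ∀ x y : H, ⟪Linv x, y⟫ = ⟪x, Linv y⟫ := hLinvsa.isSymmetric
  have hST : ∀ x : L0.domain, Linv (L0 x) = x := fun x => by
    have hx : L0 x = L ⟨x, hL0L.1 x.2⟩ := hL0L.2 rfl
    rw [hx, hinvl]
  have hu0hv : ⟪L0 u0, hv⟫ = 0 :=
    inner_eq_zero_symm.mp (inner_apply_eq_zero_of_mem_pker_adjoint hdense hhv u0)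
  rw [adjoint_apply_of_eq_add hdense hsym hS hST hhu hueq,
    adjoint_apply_of_eq_add hdense hsym hS hST hhv hveq, hueq, hveq]
  simp only [inner_add_left, inner_add_right]
  rw [hsym, ← hS (L0 u0), hST, hu0hv, hS gu (L0 v0), hST, hS gu gv,
    inner_apply_eq_zero_of_mem_pker_adjoint hdense hhu]
  ring
end

section
/- (Green formula; main content of Lemma 1.) Let L0 be a closed densely defined symmetric positive definite operator in a complex Hilbert space H, K := Ker L0*, P the orthogonal projection of H onto K, and L a positive definite self-adjoint extension of L0 with bounded everywhere-defined inverse L⁻¹. Define the boundary operators Γ1, Γ2 on Dom L0* by Γ1 y := L⁻¹(L0* y) − y and Γ2 y := P(L0* y). Then for all u, v ∈ Dom L0*: ⟪L0* u, v⟫ − ⟪u, L0* v⟫ = ⟪Γ1 u, Γ2 v⟫ − ⟪Γ2 u, Γ1 v⟫. -/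
local notation "⟪" x ", " y "⟫" => @inner ℂ _ _ x y

/-- A vector orthogonal to the range of a densely defined operator lies in the kernel of its
adjoint. -/
theorem mem_pker_adjoint_of_inner_eq_zero {H : Type*} [NormedAddCommGroup H]
    [InnerProductSpace ℂ H] [CompleteSpace H] {T : H →ₗ.[ℂ] H} (hT : Dense (T.domain : Set H))
    {y : H} (hy : ∀ x : T.domain, inner ℂ y (T x) = 0) : y ∈ pker T.adjoint := by
  have hmem : y ∈ T.adjoint.domain :=
    T.mem_adjoint_domain_of_exists y ⟨0, fun x => by rw [hy x, inner_zero_left]⟩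
  have hzero : T.adjoint ⟨y, hmem⟩ = 0 :=
    LinearPMap.adjoint_apply_eq hT _ fun x => by rw [hy x, inner_zero_left]
  exact ⟨⟨y, hmem⟩, hzero, rfl⟩

/-- Green formula for the canonical boundary operators (Lemma 1). -/
theorem statement4 {H : Type*} [NormedAddCommGroup H] [InnerProductSpace ℂ H] [CompleteSpace H]
    (L0 : H →ₗ.[ℂ] H)
    (hdense : Dense (L0.domain : Set H))
    (hclosed : L0.IsClosed)
    (hsym : ∀ u v : L0.domain, ⟪L0 u, (v : H)⟫ = ⟪(u : H), L0 v⟫)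
    (κ : ℝ) (hκ : 0 < κ)
    (hpos : ∀ y : L0.domain, κ * ‖(y : H)‖ ^ 2 ≤ (⟪L0 y, (y : H)⟫).re)
    -- `L` is a self-adjoint extension of `L0`, positive definite, bijective onto `H`
    (L : H →ₗ.[ℂ] H) (hL0L : L0 ≤ L) (hLsa : L.adjoint = L)
    (hLpos : ∀ y : L.domain, κ * ‖(y : H)‖ ^ 2 ≤ (⟪L y, (y : H)⟫).re)
    -- `Linv` is the (bounded, everywhere-defined, self-adjoint) inverse of `L`
    (Linv : H →L[ℂ] H) (hLinvsa : IsSelfAdjoint Linv)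
    (hinvl : ∀ x : L.domain, Linv (L x) = (x : H))
    (hinvmem : ∀ x : H, Linv x ∈ L.domain)
    (hinvr : ∀ x : H, L ⟨Linv x, hinvmem x⟩ = x)
    -- `P` is the orthogonal projection of `H` onto `K = Ker L0*`
    (P : H →L[ℂ] H)
    (hPmem : ∀ x : H, P x ∈ pker L0.adjoint)
    (hPorth : ∀ x : H, x - P x ∈ (pker L0.adjoint)ᗮ) :
    -- Green formula with `Γ1 y = L⁻¹ (L0* y) - y` and `Γ2 y = P (L0* y)`
    ∀ u v : L0.adjoint.domain,
      ⟪L0.adjoint u, (v : H)⟫ - ⟪(u : H), L0.adjoint v⟫ =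
        ⟪Linv (L0.adjoint u) - (u : H), P (L0.adjoint v)⟫
          - ⟪P (L0.adjoint u), Linv (L0.adjoint v) - (v : H)⟫ := by
  have hLinv (x y : H) : ⟪Linv x, y⟫ = ⟪x, Linv y⟫ := hLinvsa.isSymmetric x y
  have hΓ₁ (u : L0.adjoint.domain) : Linv (L0.adjoint u) - (u : H) ∈ pker L0.adjoint := by
    refine mem_pker_adjoint_of_inner_eq_zero hdense fun x => ?_
    have hx : Linv (L0 x) = (x : H) := by
      rw [hL0L.2 (y := ⟨x, hL0L.1 x.2⟩) rfl]
      exact hinvl _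
    rw [inner_sub_left, hLinv, hx, LinearPMap.adjoint_isFormalAdjoint hdense u x, sub_self]
  have hP_right {k : H} (hk : k ∈ pker L0.adjoint) (x : H) : ⟪k, P x⟫ = ⟪k, x⟫ := by
    have h := Submodule.inner_right_of_mem_orthogonal hk (hPorth x)
    rw [inner_sub_right, sub_eq_zero] at h
    exact h.symm
  have hP_left {k : H} (hk : k ∈ pker L0.adjoint) (x : H) : ⟪P x, k⟫ = ⟪x, k⟫ := by
    rw [← inner_conj_symm, hP_right hk, inner_conj_symm]
  intro u v
  rw [hP_right (hΓ₁ u), hP_left (hΓ₁ v), inner_sub_left, inner_sub_right, hLinv]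
  ring
end
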